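/- arXiv:quant-ph/0109033 — 5 statements merged into one kernel-verified Lean document; each statement's English description precedes it below -/
import Mathlib

section
/- Let T be the 4×4 complex matrix T = (1/√2) · [[1,0,0,1],[0,i,i,0],[0,−1,1,0],[i,0,0,−i]]. For all 2×2 complex matrices U₁, U₂ that are unitary with determinant 1 (i.e. U₁, U₂ ∈ SU(2)), the matrix M = T (U₁ ⊗ U₂) T† (where ⊗ is the Kronecker product and T† is the conjugate transpose) has all entries real, satisfies Mᵀ M = I₄, and has det M = 1; that is, M is (the complexification of) a real special orthogonal 4×4 matrix. -/
open Matrix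

noncomputable section

/-- The fixed matrix `T = (1/√2)·[[1,0,0,1],[0,i,i,0],[0,-1,1,0],[i,0,0,-i]]`. -/
noncomputable def Tmat : Matrix (Fin 4) (Fin 4) ℂ :=
  ((1 / Real.sqrt 2 : ℝ) : ℂ) •
    !![1, 0, 0, 1;
       0, Complex.I, Complex.I, 0;
       0, -1, 1, 0;
       Complex.I, 0, 0, -Complex.I]

/-- The index identification `(i,j) ↦ 2i+j` between `Fin 2 × Fin 2` (ordered 00,01,10,11)
and `Fin 4`. -/
def qIdx : Fin 2 × Fin 2 ≃ Fin 4 where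
  toFun p := ⟨2 * p.1.val + p.2.val, by have h1 := p.1.isLt; have h2 := p.2.isLt; omega⟩
  invFun k := (⟨k.val / 2, by have := k.isLt; omega⟩, ⟨k.val % 2, by have := k.isLt; omega⟩)
  left_inv := by decide
  right_inv := by decide

/-- Kronecker product of two `2×2` matrices as a `4×4` matrix (basis ordered 00,01,10,11). -/
def kron (A B : Matrix (Fin 2) (Fin 2) ℂ) : Matrix (Fin 4) (Fin 4) ℂ :=
  fun r c => A (qIdx.symm r).1 (qIdx.symm c).1 * B (qIdx.symm r).2 (qIdx.symm c).2

open scoped Kronecker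

theorem kron_eq_submatrix (A B : Matrix (Fin 2) (Fin 2) ℂ) :
    kron A B = (A ⊗ₖ B).submatrix qIdx.symm qIdx.symm := rfl

theorem kron_mul_kron (A B C D : Matrix (Fin 2) (Fin 2) ℂ) :
    kron A B * kron C D = kron (A * C) (B * D) := by
  rw [kron_eq_submatrix, kron_eq_submatrix, kron_eq_submatrix, submatrix_mul_equiv,
    mul_kronecker_mul]

theorem kron_one : kron 1 1 = 1 := by
  rw [kron_eq_submatrix, one_kronecker_one, submatrix_one_equiv]

theorem transpose_kron (A B : Matrix (Fin 2) (Fin 2) ℂ) : (kron A B)ᵀ = kron Aᵀ Bᵀ := rfl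

theorem conjTranspose_kron (A B : Matrix (Fin 2) (Fin 2) ℂ) : (kron A B)ᴴ = kron Aᴴ Bᴴ := by
  ext i j
  simp [kron]

theorem det_kron (A B : Matrix (Fin 2) (Fin 2) ℂ) : (kron A B).det = A.det ^ 2 * B.det ^ 2 := by
  rw [kron_eq_submatrix, det_submatrix_equiv_self, det_kronecker, Fintype.card_fin]

/-- The standard symplectic form on `ℂ²`. -/
def symplecticForm : Matrix (Fin 2) (Fin 2) ℂ := !![0, 1; -1, 0]

theorem transpose_mul_symplecticForm_mul (A : Matrix (Fin 2) (Fin 2) ℂ) :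
    Aᵀ * symplecticForm * A = A.det • symplecticForm := by
  ext i j
  fin_cases i <;> fin_cases j <;>
    simp [symplecticForm, mul_apply, Fin.sum_univ_two, det_fin_two] <;> ring

theorem one_div_sqrt_two_mul_self :
    ((1 / Real.sqrt 2 : ℝ) : ℂ) * ((1 / Real.sqrt 2 : ℝ) : ℂ) = 1 / 2 := by
  rw [← Complex.ofReal_mul, div_mul_div_comm, Real.mul_self_sqrt zero_le_two]
  norm_num

theorem Tmat_mul_conjTranspose : Tmat * Tmatᴴ = 1 := by
  rw [Tmat, conjTranspose_smul, smul_mul_smul_comm, Complex.star_def, Complex.conj_ofReal,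
    one_div_sqrt_two_mul_self]
  ext i j
  simp only [Matrix.smul_apply, mul_apply, conjTranspose_apply, Fin.sum_univ_four]
  fin_cases i <;> fin_cases j <;> simp <;> norm_num

theorem transpose_Tmat_mul_self : Tmatᵀ * Tmat = kron symplecticForm symplecticForm := by
  rw [Tmat, transpose_smul, smul_mul_smul_comm, one_div_sqrt_two_mul_self]
  ext i j
  simp only [Matrix.smul_apply, mul_apply, transpose_apply, Fin.sum_univ_four]
  fin_cases i <;> fin_cases j <;> simp [kron, qIdx, symplecticForm] <;> norm_num

theorem im_eq_zero_of_unitary_of_orthogonal {n : Type*} [Fintype n] [DecidableEq n]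
    {M : Matrix n n ℂ} (hu : Mᴴ * M = 1) (ho : Mᵀ * M = 1) (i j : n) : (M i j).im = 0 := by
  have h : Mᴴ = Mᵀ := left_inv_eq_right_inv hu (mul_eq_one_comm.mp ho)
  exact Complex.conj_eq_iff_im.mp (congrFun (congrFun h j) i)

/-- For `U₁, U₂ ∈ SU(2)`, the matrix `M = T (U₁ ⊗ U₂) T†` is real, satisfies `Mᵀ M = 1`
and `det M = 1`, i.e. it is (the complexification of) a real special orthogonal matrix. -/
theorem su2_su2_to_so4_real (U₁ U₂ : Matrix (Fin 2) (Fin 2) ℂ)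
    (hU₁ : U₁ᴴ * U₁ = 1) (hU₂ : U₂ᴴ * U₂ = 1)
    (hd₁ : U₁.det = 1) (hd₂ : U₂.det = 1) :
    (∀ i j, ((Tmat * kron U₁ U₂ * Tmatᴴ) i j).im = 0) ∧
    (Tmat * kron U₁ U₂ * Tmatᴴ)ᵀ * (Tmat * kron U₁ U₂ * Tmatᴴ) = 1 ∧
    (Tmat * kron U₁ U₂ * Tmatᴴ).det = 1 := by
  have hTT : Tmatᴴ * Tmat = 1 := mul_eq_one_comm.mp Tmat_mul_conjTranspose
  have hK : (kron U₁ U₂)ᴴ * kron U₁ U₂ = 1 := by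
    rw [conjTranspose_kron, kron_mul_kron, hU₁, hU₂, kron_one]
  have hE : (kron U₁ U₂)ᵀ * (Tmatᵀ * Tmat) * kron U₁ U₂ = Tmatᵀ * Tmat := by
    rw [transpose_Tmat_mul_self, transpose_kron, kron_mul_kron, kron_mul_kron,
      transpose_mul_symplecticForm_mul, transpose_mul_symplecticForm_mul, hd₁, hd₂, one_smul]
  have hu : (Tmat * kron U₁ U₂ * Tmatᴴ)ᴴ * (Tmat * kron U₁ U₂ * Tmatᴴ) = 1 := by
    calc _ = Tmat * ((kron U₁ U₂)ᴴ * (Tmatᴴ * Tmat) * kron U₁ U₂) * Tmatᴴ := by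
          simp only [conjTranspose_mul, conjTranspose_conjTranspose, Matrix.mul_assoc]
      _ = 1 := by rw [hTT, Matrix.mul_one, hK, Matrix.mul_one, Tmat_mul_conjTranspose]
  have ho : (Tmat * kron U₁ U₂ * Tmatᴴ)ᵀ * (Tmat * kron U₁ U₂ * Tmatᴴ) = 1 := by
    calc _ = Tmatᴴᵀ * ((kron U₁ U₂)ᵀ * (Tmatᵀ * Tmat) * kron U₁ U₂) * Tmatᴴ := by
          simp only [transpose_mul, Matrix.mul_assoc]
      _ = (Tmat * Tmatᴴ)ᵀ * (Tmat * Tmatᴴ) := by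
          rw [hE]
          simp only [transpose_mul, Matrix.mul_assoc]
      _ = 1 := by rw [Tmat_mul_conjTranspose, transpose_one, Matrix.mul_one]
  refine ⟨im_eq_zero_of_unitary_of_orthogonal hu ho, ho, ?_⟩
  rw [det_mul_right_comm, Tmat_mul_conjTranspose, Matrix.one_mul, det_kron, hd₁, hd₂]
  norm_num
end
end

section
/- Let T be the 4×4 complex matrix T = (1/√2) · [[1,0,0,1],[0,i,i,0],[0,−1,1,0],[i,0,0,−i]]. For every real 4×4 matrix O with Oᵀ O = I₄ and det O = 1 (i.e. O ∈ SO(4,ℝ)), there exist U₁, U₂ ∈ SU(2) such that O, regarded as a complex matrix, equals T (U₁ ⊗ U₂) T†. In other words, the homomorphism (U₁,U₂) ↦ T(U₁⊗U₂)T† from SU(2)×SU(2) onto SO(4,ℝ) is surjective. -/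
open Matrix

noncomputable section

open scoped Quaternion

/-- The reflection of `ℍ` in the hyperplane orthogonal to a unit quaternion `v`. -/
lemma Quaternion.reflection_orthogonal_singleton_of_norm_eq_one {v : ℍ[ℝ]} (hv : ‖v‖ = 1)
    (x : ℍ[ℝ]) : (ℝ ∙ v)ᗮ.reflection x = -v * star x * v := by
  have h : v.re ^ 2 + v.imI ^ 2 + v.imJ ^ 2 + v.imK ^ 2 = 1 := by
    rw [← Quaternion.normSq_def', Quaternion.normSq_eq_norm_mul_self, hv, one_mul]
  rw [Submodule.reflection_orthogonal_apply, Submodule.reflection_singleton_apply, hv,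
    Quaternion.inner_def, two_smul]
  ext <;> simp
  · linear_combination (-x.re) * h
  · linear_combination (-x.imI) * h
  · linear_combination (-x.imJ) * h
  · linear_combination (-x.imK) * h

/-- Every hyperplane reflection of `ℍ`, possibly degenerate, is the identity or
`x ↦ -u * star x * u` for a unit quaternion `u`. -/
lemma Quaternion.reflection_orthogonal_singleton (v : ℍ[ℝ]) :
    (∀ x, (ℝ ∙ v)ᗮ.reflection x = x) ∨
      ∃ u : ℍ[ℝ], ‖u‖ = 1 ∧ ∀ x, (ℝ ∙ v)ᗮ.reflection x = -u * star x * u := by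
  rcases eq_or_ne v 0 with rfl | hv
  · left
    intro x
    rw [Submodule.reflection_eq_self_iff, Submodule.span_zero_singleton,
      Submodule.bot_orthogonal_eq_top]
    exact Submodule.mem_top
  · right
    have hu : ‖(‖v‖⁻¹ : ℝ) • v‖ = 1 := by
      rw [norm_smul, norm_inv, norm_norm, inv_mul_cancel₀ (norm_ne_zero_iff.mpr hv)]
    refine ⟨(‖v‖⁻¹ : ℝ) • v, hu, fun x => ?_⟩
    rw [← Quaternion.reflection_orthogonal_singleton_of_norm_eq_one hu]
    have hspan : (ℝ ∙ ((‖v‖⁻¹ : ℝ) • v)) = ℝ ∙ v :=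
      Submodule.span_singleton_smul_eq
        (IsUnit.mk0 _ (inv_ne_zero (norm_ne_zero_iff.mpr hv))) v
    simp only [hspan]

/-- Every linear isometry of `ℍ` is `x ↦ p * x * r` or `x ↦ p * star x * r` for unit
quaternions `p` and `r`. -/
lemma Quaternion.exists_linearIsometryEquiv_eq_mul_mul (φ : ℍ[ℝ] ≃ₗᵢ[ℝ] ℍ[ℝ]) :
    ∃ p r : ℍ[ℝ], ‖p‖ = 1 ∧ ‖r‖ = 1 ∧
      ((∀ x, φ x = p * x * r) ∨ ∀ x, φ x = p * star x * r) := by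
  obtain ⟨l, -, rfl⟩ := φ.reflections_generate_dim
  induction l with
  | nil => exact ⟨1, 1, by simp, by simp, Or.inl fun x => by simp⟩
  | cons v l ih =>
    obtain ⟨p, r, hp, hr, h⟩ := ih
    simp only [List.map_cons, List.prod_cons, LinearIsometryEquiv.coe_mul, Function.comp_apply]
    rcases Quaternion.reflection_orthogonal_singleton v with hv | ⟨u, hu, hv⟩
    · exact ⟨p, r, hp, hr, by simpa only [hv] using h⟩
    · refine ⟨-u * star r, star p * u, by simp [hu, hr], by simp [hu, hp], ?_⟩
      rcases h with h | h
      · right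
        intro x
        rw [hv, h]
        simp [mul_assoc]
      · left
        intro x
        rw [hv, h]
        simp [mul_assoc]

/-- The matrix of left multiplication by a quaternion. -/
def quatLeftMatrix (p : ℍ[ℝ]) : Matrix (Fin 4) (Fin 4) ℝ :=
  !![p.re, -p.imI, -p.imJ, -p.imK;
     p.imI, p.re, -p.imK, p.imJ;
     p.imJ, p.imK, p.re, -p.imI;
     p.imK, -p.imJ, p.imI, p.re]

/-- The matrix of right multiplication by a quaternion. -/
def quatRightMatrix (r : ℍ[ℝ]) : Matrix (Fin 4) (Fin 4) ℝ :=
  !![r.re, -r.imI, -r.imJ, -r.imK;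
     r.imI, r.re, r.imK, -r.imJ;
     r.imJ, -r.imK, r.re, r.imI;
     r.imK, r.imJ, -r.imI, r.re]

/-- The matrix of quaternion conjugation. -/
def quatStarMatrix : Matrix (Fin 4) (Fin 4) ℝ :=
  !![1, 0, 0, 0; 0, -1, 0, 0; 0, 0, -1, 0; 0, 0, 0, -1]

lemma quatLeftMatrix_mulVec (p x : ℍ[ℝ]) :
    quatLeftMatrix p *ᵥ Quaternion.equivTuple ℝ x = Quaternion.equivTuple ℝ (p * x) := by
  ext i
  fin_cases i <;>
    simp [quatLeftMatrix, Matrix.mulVec, dotProduct, Fin.sum_univ_four] <;> ring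

lemma quatRightMatrix_mulVec (r x : ℍ[ℝ]) :
    quatRightMatrix r *ᵥ Quaternion.equivTuple ℝ x = Quaternion.equivTuple ℝ (x * r) := by
  ext i
  fin_cases i <;>
    simp [quatRightMatrix, Matrix.mulVec, dotProduct, Fin.sum_univ_four] <;> ring

lemma quatStarMatrix_mulVec (x : ℍ[ℝ]) :
    quatStarMatrix *ᵥ Quaternion.equivTuple ℝ x = Quaternion.equivTuple ℝ (star x) := by
  ext i
  fin_cases i <;>
    simp [quatStarMatrix, Matrix.mulVec, dotProduct, Fin.sum_univ_four]

lemma det_quatLeftMatrix (p : ℍ[ℝ]) : (quatLeftMatrix p).det = ‖p‖ ^ 4 := by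
  have h : ‖p‖ ^ 4 = Quaternion.normSq p ^ 2 := by
    rw [Quaternion.normSq_eq_norm_mul_self]; ring
  rw [h, Quaternion.normSq_def']
  simp [quatLeftMatrix, Matrix.det_succ_row_zero, Fin.sum_univ_succ, Fin.succAbove]
  ring

lemma det_quatRightMatrix (r : ℍ[ℝ]) : (quatRightMatrix r).det = ‖r‖ ^ 4 := by
  have h : ‖r‖ ^ 4 = Quaternion.normSq r ^ 2 := by
    rw [Quaternion.normSq_eq_norm_mul_self]; ring
  rw [h, Quaternion.normSq_def']
  simp [quatRightMatrix, Matrix.det_succ_row_zero, Fin.sum_univ_succ, Fin.succAbove]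
  ring

lemma det_quatStarMatrix : quatStarMatrix.det = -1 := by
  simp [quatStarMatrix, Matrix.det_succ_row_zero, Fin.sum_univ_succ, Fin.succAbove]

/-- An orthogonal `4×4` matrix acts on `ℍ` by a linear isometry. -/
lemma exists_quaternion_linearIsometryEquiv {O : Matrix (Fin 4) (Fin 4) ℝ} (hO : Oᵀ * O = 1) :
    ∃ φ : ℍ[ℝ] ≃ₗᵢ[ℝ] ℍ[ℝ],
      ∀ x, Quaternion.equivTuple ℝ (φ x) = O *ᵥ Quaternion.equivTuple ℝ x := by
  let e := Quaternion.linearIsometryEquivTuple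
  let f : EuclideanSpace ℝ (Fin 4) →ₗᵢ[ℝ] EuclideanSpace ℝ (Fin 4) :=
    (Matrix.toEuclideanLin O).isometryOfInner fun x y => by
      simp only [EuclideanSpace.inner_eq_star_dotProduct, Matrix.ofLp_toLpLin,
        Matrix.toLin'_apply, star_trivial]
      rw [Matrix.dotProduct_mulVec, ← Matrix.mulVec_transpose, Matrix.mulVec_mulVec, hO,
        Matrix.one_mulVec]
  refine ⟨(e.trans (f.toLinearIsometryEquiv rfl)).trans e.symm, fun x => ?_⟩
  have h (y : EuclideanSpace ℝ (Fin 4)) : Quaternion.equivTuple ℝ (e.symm y) = y.ofLp := by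
    ext i
    fin_cases i <;> rfl
  rw [LinearIsometryEquiv.trans_apply, h]
  rfl

/-- Every element of `SO(4,ℝ)` is a product of a left and a right multiplication by unit
quaternions. -/
lemma exists_eq_quatLeftMatrix_mul_quatRightMatrix {O : Matrix (Fin 4) (Fin 4) ℝ}
    (hO : Oᵀ * O = 1) (hdet : O.det = 1) :
    ∃ p r : ℍ[ℝ], ‖p‖ = 1 ∧ ‖r‖ = 1 ∧ O = quatLeftMatrix p * quatRightMatrix r := by
  obtain ⟨φ, hφ⟩ := exists_quaternion_linearIsometryEquiv hO
  obtain ⟨p, r, hp, hr, h⟩ := Quaternion.exists_linearIsometryEquiv_eq_mul_mul φ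
  refine ⟨p, r, hp, hr, ?_⟩
  rcases h with h | h
  · refine Matrix.mulVec_injective (funext fun v => ?_)
    obtain ⟨x, rfl⟩ := (Quaternion.equivTuple ℝ).surjective v
    rw [← hφ, h, ← Matrix.mulVec_mulVec, quatRightMatrix_mulVec, quatLeftMatrix_mulVec, mul_assoc]
  · have hC : O = quatLeftMatrix p * quatRightMatrix r * quatStarMatrix := by
      refine Matrix.mulVec_injective (funext fun v => ?_)
      obtain ⟨x, rfl⟩ := (Quaternion.equivTuple ℝ).surjective v
      rw [← hφ, h, ← Matrix.mulVec_mulVec, quatStarMatrix_mulVec, ← Matrix.mulVec_mulVec,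
        quatRightMatrix_mulVec, quatLeftMatrix_mulVec, mul_assoc]
    rw [hC, Matrix.det_mul, Matrix.det_mul, det_quatLeftMatrix, det_quatRightMatrix,
      det_quatStarMatrix, hp, hr] at hdet
    norm_num at hdet

/-- The representation of quaternions by complex `2×2` matrices that sends the units
`i`, `j`, `k` to `-i` times the Pauli matrices. -/
def quatToComplexMatrix (q : ℍ[ℝ]) : Matrix (Fin 2) (Fin 2) ℂ :=
  !![⟨q.re, -q.imK⟩, ⟨-q.imJ, -q.imI⟩; ⟨q.imJ, -q.imI⟩, ⟨q.re, q.imK⟩]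

lemma quatToComplexMatrix_conjTranspose_mul_self {q : ℍ[ℝ]} (hq : ‖q‖ = 1) :
    (quatToComplexMatrix q)ᴴ * quatToComplexMatrix q = 1 := by
  have h : q.re ^ 2 + q.imI ^ 2 + q.imJ ^ 2 + q.imK ^ 2 = 1 := by
    rw [← Quaternion.normSq_def', Quaternion.normSq_eq_norm_mul_self, hq, one_mul]
  ext i j
  fin_cases i <;> fin_cases j <;> apply Complex.ext <;>
    simp [quatToComplexMatrix, Matrix.mul_apply, Fin.sum_univ_two] <;> grind

lemma det_quatToComplexMatrix {q : ℍ[ℝ]} (hq : ‖q‖ = 1) : (quatToComplexMatrix q).det = 1 := by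
  have h : q.re ^ 2 + q.imI ^ 2 + q.imJ ^ 2 + q.imK ^ 2 = 1 := by
    rw [← Quaternion.normSq_def', Quaternion.normSq_eq_norm_mul_self, hq, one_mul]
  rw [Matrix.det_fin_two]
  apply Complex.ext <;> simp [quatToComplexMatrix] <;> grind

lemma Tmat_mul_mul_conjTranspose (M : Matrix (Fin 4) (Fin 4) ℂ) :
    Tmat * M * Tmatᴴ = (1 / 2 : ℂ) •
      (!![1, 0, 0, 1; 0, Complex.I, Complex.I, 0; 0, -1, 1, 0; Complex.I, 0, 0, -Complex.I] * M *
        !![1, 0, 0, -Complex.I; 0, -Complex.I, -1, 0; 0, -Complex.I, 1, 0;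
          1, 0, 0, Complex.I]) := by
  have hT : Tmatᴴ = ((1 / Real.sqrt 2 : ℝ) : ℂ) •
      !![1, 0, 0, -Complex.I; 0, -Complex.I, -1, 0; 0, -Complex.I, 1, 0; 1, 0, 0, Complex.I] := by
    ext i j
    fin_cases i <;> fin_cases j <;> simp [Tmat]
  have hs : ((1 / Real.sqrt 2 : ℝ) : ℂ) * ((1 / Real.sqrt 2 : ℝ) : ℂ) = 1 / 2 := by
    rw [← Complex.ofReal_mul, div_mul_div_comm, Real.mul_self_sqrt (by norm_num)]
    norm_num
  rw [hT, Tmat, Matrix.smul_mul, Matrix.smul_mul, Matrix.mul_smul, smul_smul, hs]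

lemma kron_eq (A B : Matrix (Fin 2) (Fin 2) ℂ) :
    kron A B =
      !![A 0 0 * B 0 0, A 0 0 * B 0 1, A 0 1 * B 0 0, A 0 1 * B 0 1;
         A 0 0 * B 1 0, A 0 0 * B 1 1, A 0 1 * B 1 0, A 0 1 * B 1 1;
         A 1 0 * B 0 0, A 1 0 * B 0 1, A 1 1 * B 0 0, A 1 1 * B 0 1;
         A 1 0 * B 1 0, A 1 0 * B 1 1, A 1 1 * B 1 0, A 1 1 * B 1 1] := by
  ext i j
  fin_cases i <;> fin_cases j <;> rfl

set_option maxHeartbeats 2000000 in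
lemma map_quatLeftMatrix_mul_quatRightMatrix (p r : ℍ[ℝ]) :
    (quatLeftMatrix p * quatRightMatrix r).map Complex.ofReal =
      Tmat * kron (quatToComplexMatrix p) (quatToComplexMatrix r)ᵀ * Tmatᴴ := by
  rw [Tmat_mul_mul_conjTranspose, kron_eq]
  ext i j
  fin_cases i <;> fin_cases j <;> apply Complex.ext <;>
    simp [quatLeftMatrix, quatRightMatrix, quatToComplexMatrix] <;> ring

/-- Every `O ∈ SO(4,ℝ)`, regarded as a complex matrix, is of the form `T (U₁ ⊗ U₂) T†`
for some `U₁, U₂ ∈ SU(2)`: the homomorphism `SU(2)×SU(2) → SO(4,ℝ)` is surjective. -/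
theorem su2_su2_onto_so4_real (O : Matrix (Fin 4) (Fin 4) ℝ)
    (hO : Oᵀ * O = 1) (hdet : O.det = 1) :
    ∃ U₁ U₂ : Matrix (Fin 2) (Fin 2) ℂ,
      U₁ᴴ * U₁ = 1 ∧ U₂ᴴ * U₂ = 1 ∧ U₁.det = 1 ∧ U₂.det = 1 ∧
      O.map (Complex.ofReal) = Tmat * kron U₁ U₂ * Tmatᴴ := by
  obtain ⟨p, r, hp, hr, rfl⟩ := exists_eq_quatLeftMatrix_mul_quatRightMatrix hO hdet
  refine ⟨quatToComplexMatrix p, (quatToComplexMatrix r)ᵀ,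
    quatToComplexMatrix_conjTranspose_mul_self hp, ?_, det_quatToComplexMatrix hp, ?_,
    map_quatLeftMatrix_mul_quatRightMatrix p r⟩
  · rw [Matrix.conjTranspose_transpose_eq_transpose_conjTranspose, ← Matrix.transpose_mul,
      mul_eq_one_comm.mp (quatToComplexMatrix_conjTranspose_mul_self hr), Matrix.transpose_one]
  · rw [Matrix.det_transpose, det_quatToComplexMatrix hr]
end
end

section
/- Let a, b, c, d ∈ ℂ and let ψ be the four-qubit tensor G_abcd = ((a+d)/2)(|0000⟩+|1111⟩) + ((a−d)/2)(|0011⟩+|1100⟩) + ((b+c)/2)(|0101⟩+|1010⟩) + ((b−c)/2)(|0110⟩+|1001⟩). Then for each qubit k ∈ {1,2,3,4}, the single-qubit reduced density matrix ρ_k of ψ — the 2×2 matrix with entries (ρ_k)_{i,i′} = Σ over the other three indices of ψ(...i at position k...) · conj(ψ(...i′ at position k...)) — equals ((|a|² + |b|² + |c|² + |d|²)/2) · I₂. In particular all four local density operators of G_abcd are proportional to the identity. -/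
open Matrix

noncomputable section

/-- The standard basis ket `|i₁i₂i₃i₄⟩`. -/
def ket (i₁ i₂ i₃ i₄ : Fin 2) : Fin 2 → Fin 2 → Fin 2 → Fin 2 → ℂ :=
  fun j₁ j₂ j₃ j₄ => if j₁ = i₁ ∧ j₂ = i₂ ∧ j₃ = i₃ ∧ j₄ = i₄ then 1 else 0

/-- The generic family `G_abcd`. -/
def Gfam (a b c d : ℂ) : Fin 2 → Fin 2 → Fin 2 → Fin 2 → ℂ :=
  ((a + d) / 2) • (ket 0 0 0 0 + ket 1 1 1 1) + ((a - d) / 2) • (ket 0 0 1 1 + ket 1 1 0 0) +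
  ((b + c) / 2) • (ket 0 1 0 1 + ket 1 0 1 0) + ((b - c) / 2) • (ket 0 1 1 0 + ket 1 0 0 1)

/-- The reduced density matrix of qubit 1. -/
def rho1 (ψ : Fin 2 → Fin 2 → Fin 2 → Fin 2 → ℂ) : Matrix (Fin 2) (Fin 2) ℂ :=
  fun i i' => ∑ j₂, ∑ j₃, ∑ j₄, ψ i j₂ j₃ j₄ * star (ψ i' j₂ j₃ j₄)

/-- The reduced density matrix of qubit 2. -/
def rho2 (ψ : Fin 2 → Fin 2 → Fin 2 → Fin 2 → ℂ) : Matrix (Fin 2) (Fin 2) ℂ :=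
  fun i i' => ∑ j₁, ∑ j₃, ∑ j₄, ψ j₁ i j₃ j₄ * star (ψ j₁ i' j₃ j₄)

/-- The reduced density matrix of qubit 3. -/
def rho3 (ψ : Fin 2 → Fin 2 → Fin 2 → Fin 2 → ℂ) : Matrix (Fin 2) (Fin 2) ℂ :=
  fun i i' => ∑ j₁, ∑ j₂, ∑ j₄, ψ j₁ j₂ i j₄ * star (ψ j₁ j₂ i' j₄)

/-- The reduced density matrix of qubit 4. -/
def rho4 (ψ : Fin 2 → Fin 2 → Fin 2 → Fin 2 → ℂ) : Matrix (Fin 2) (Fin 2) ℂ :=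
  fun i i' => ∑ j₁, ∑ j₂, ∑ j₃, ψ j₁ j₂ j₃ i * star (ψ j₁ j₂ j₃ i') 

/-- All four single-qubit reduced density matrices of `G_abcd` are proportional to the
identity, with proportionality constant `(|a|²+|b|²+|c|²+|d|²)/2`. -/
theorem Gfam_reduced_density_maximally_mixed (a b c d : ℂ) :
    rho1 (Gfam a b c d) =
      (((Complex.normSq a + Complex.normSq b + Complex.normSq c + Complex.normSq d) / 2 : ℝ) : ℂ) • 1 ∧
    rho2 (Gfam a b c d) =
      (((Complex.normSq a + Complex.normSq b + Complex.normSq c + Complex.normSq d) / 2 : ℝ) : ℂ) • 1 ∧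
    rho3 (Gfam a b c d) =
      (((Complex.normSq a + Complex.normSq b + Complex.normSq c + Complex.normSq d) / 2 : ℝ) : ℂ) • 1 ∧
    rho4 (Gfam a b c d) =
      (((Complex.normSq a + Complex.normSq b + Complex.normSq c + Complex.normSq d) / 2 : ℝ) : ℂ) • 1 := by
  refine ⟨?_, ?_, ?_, ?_⟩ <;> ext i j <;> fin_cases i <;> fin_cases j <;>
    simp [rho1, rho2, rho3, rho4, Gfam, ket, Fin.sum_univ_two, Complex.normSq_eq_conj_mul_self,
      Complex.conj_ofNat] <;>
    ring
end
end

section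
/- Let a, b, c, d ∈ ℂ and let ψ be the four-qubit tensor G_abcd = ((a+d)/2)(|0000⟩+|1111⟩) + ((a−d)/2)(|0011⟩+|1100⟩) + ((b+c)/2)(|0101⟩+|1010⟩) + ((b−c)/2)(|0110⟩+|1001⟩). Let R(ψ) = T ψ̃ T† and P(ψ) = [[0, R(ψ)],[R(ψ)ᵀ, 0]]. Then the characteristic polynomial of the 8×8 matrix P(ψ) equals (X²−a²)(X²−b²)(X²−c²)(X²−d²); that is, the eigenvalues of P(G_abcd) are ±a, ±b, ±c, ±d. -/
open Matrix

noncomputable section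

/-- The reshaping `ψ̃` of a four-qubit tensor into a `4×4` matrix, with row index
`(i₁,i₂)` and column index `(i₃,i₄)`, bases ordered 00,01,10,11. -/
def reshape (ψ : Fin 2 → Fin 2 → Fin 2 → Fin 2 → ℂ) : Matrix (Fin 4) (Fin 4) ℂ :=
  fun r c => ψ (qIdx.symm r).1 (qIdx.symm r).2 (qIdx.symm c).1 (qIdx.symm c).2

/-- The matrix `R(ψ) = T ψ̃ T†`. -/
noncomputable def Rmat (ψ : Fin 2 → Fin 2 → Fin 2 → Fin 2 → ℂ) : Matrix (Fin 4) (Fin 4) ℂ :=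
  Tmat * reshape ψ * Tmatᴴ

/-- The action of `A₁ ⊗ A₂ ⊗ A₃ ⊗ A₄` on a four-qubit tensor. -/
def act (A₁ A₂ A₃ A₄ : Matrix (Fin 2) (Fin 2) ℂ) (ψ : Fin 2 → Fin 2 → Fin 2 → Fin 2 → ℂ) :
    Fin 2 → Fin 2 → Fin 2 → Fin 2 → ℂ :=
  fun i₁ i₂ i₃ i₄ => ∑ j₁, ∑ j₂, ∑ j₃, ∑ j₄,
    A₁ i₁ j₁ * A₂ i₂ j₂ * A₃ i₃ j₃ * A₄ i₄ j₄ * ψ j₁ j₂ j₃ j₄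

/-- The `8×8` symmetric matrix `P(ψ) = [[0, R(ψ)],[R(ψ)ᵀ, 0]]`. -/
noncomputable def Pmat (ψ : Fin 2 → Fin 2 → Fin 2 → Fin 2 → ℂ) :
    Matrix (Fin 4 ⊕ Fin 4) (Fin 4 ⊕ Fin 4) ℂ :=
  Matrix.fromBlocks 0 (Rmat ψ) (Rmat ψ)ᵀ 0

theorem reshape_Gfam (a b c d : ℂ) :
    reshape (Gfam a b c d) =
      !![(a + d) / 2, 0, 0, (a - d) / 2;
         0, (b + c) / 2, (b - c) / 2, 0;
         0, (b - c) / 2, (b + c) / 2, 0;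
         (a - d) / 2, 0, 0, (a + d) / 2] := by
  ext i j
  fin_cases i <;> fin_cases j <;> simp [reshape, Gfam, ket, qIdx]

theorem Rmat_Gfam (a b c d : ℂ) : Rmat (Gfam a b c d) = diagonal ![a, b, c, d] := by
  have h : (((Real.sqrt 2 : ℝ) : ℂ))⁻¹ * (((Real.sqrt 2 : ℝ) : ℂ))⁻¹ = 1 / 2 := by
    rw [← mul_inv, ← Complex.ofReal_mul, Real.mul_self_sqrt zero_le_two]
    norm_num
  have hI := Complex.I_mul_I
  rw [Rmat, reshape_Gfam]
  ext i j
  fin_cases i <;> fin_cases j <;>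
    simp [Tmat, Matrix.mul_apply, Fin.sum_univ_four] <;>
    grind

theorem det_fromBlocks_same {n R : Type*} [Fintype n] [DecidableEq n] [CommRing R]
    (A B : Matrix n n R) : (fromBlocks A B B A).det = (A + B).det * (A - B).det := by
  have h : fromBlocks 1 1 0 1 * fromBlocks A B B A * fromBlocks 1 (-1) 0 1 =
      fromBlocks (A + B) 0 B (A - B) := by
    simp only [fromBlocks_multiply]
    congr 1 <;> simp <;> abel
  simpa using congrArg det h

open Polynomial in
theorem charpoly_fromBlocks_zero_diagonal {n R : Type*} [Fintype n] [DecidableEq n] [CommRing R]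
    (v : n → R) :
    (fromBlocks 0 (diagonal v) (diagonal v) 0).charpoly = ∏ i, (X ^ 2 - C (v i ^ 2)) := by
  rw [charpoly, charmatrix_fromBlocks, charmatrix_zero, scalar_apply,
    det_fromBlocks_same, diagonal_map C_0, diagonal_neg,
    diagonal_add, diagonal_sub, det_diagonal, det_diagonal, ← Finset.prod_mul_distrib]
  refine Finset.prod_congr rfl fun i _ => ?_
  rw [C_pow]
  ring

open Polynomial in
/-- The characteristic polynomial of `P(G_abcd)` is
`(X²−a²)(X²−b²)(X²−c²)(X²−d²)`: its eigenvalues are `±a, ±b, ±c, ±d`. -/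
theorem charpoly_Pmat_Gfam (a b c d : ℂ) :
    (Pmat (Gfam a b c d)).charpoly =
      (X ^ 2 - C (a ^ 2)) * (X ^ 2 - C (b ^ 2)) * (X ^ 2 - C (c ^ 2)) * (X ^ 2 - C (d ^ 2)) := by
  rw [Pmat, Rmat_Gfam, diagonal_transpose, charpoly_fromBlocks_zero_diagonal, Fin.prod_univ_four]
  rfl
end
end

section
/- The four-qubit W state belongs to the family L_ab₃ with a = b = 0: there exist a permutation σ of the four qubit positions and matrices A₁, A₂, A₃, A₄ ∈ SL(2,ℂ) such that applying A₁⊗A₂⊗A₃⊗A₄ to the σ-permuted four-qubit W state (1/2)(|0001⟩+|0010⟩+|0100⟩+|1000⟩) yields the state (i/√2)(|0001⟩+|0010⟩+|0111⟩+|1011⟩), which is L_ab₃ evaluated at a = b = 0. -/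
open Matrix

noncomputable section

/-- Permutation of the four qubit positions acting on a four-qubit tensor. -/
def permAct (σ : Equiv.Perm (Fin 4)) (ψ : Fin 2 → Fin 2 → Fin 2 → Fin 2 → ℂ) :
    Fin 2 → Fin 2 → Fin 2 → Fin 2 → ℂ :=
  fun i₁ i₂ i₃ i₄ =>
    ψ (![i₁, i₂, i₃, i₄] (σ 0)) (![i₁, i₂, i₃, i₄] (σ 1))
      (![i₁, i₂, i₃, i₄] (σ 2)) (![i₁, i₂, i₃, i₄] (σ 3))

/-- The family `L_{abc₂}`. -/
def Labc2 (a b c : ℂ) : Fin 2 → Fin 2 → Fin 2 → Fin 2 → ℂ :=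
  ((a + b) / 2) • (ket 0 0 0 0 + ket 1 1 1 1) + ((a - b) / 2) • (ket 0 0 1 1 + ket 1 1 0 0) +
  c • (ket 0 1 0 1 + ket 1 0 1 0) + ket 0 1 1 0

/-- The family `L_{a₂b₂}`. -/
def La2b2 (a b : ℂ) : Fin 2 → Fin 2 → Fin 2 → Fin 2 → ℂ :=
  a • (ket 0 0 0 0 + ket 1 1 1 1) + b • (ket 0 1 0 1 + ket 1 0 1 0) +
  ket 0 1 1 0 + ket 0 0 1 1

/-- The family `L_{ab₃}`. -/
noncomputable def Lab3 (a b : ℂ) : Fin 2 → Fin 2 → Fin 2 → Fin 2 → ℂ :=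
  a • (ket 0 0 0 0 + ket 1 1 1 1) + ((a + b) / 2) • (ket 0 1 0 1 + ket 1 0 1 0) +
  ((a - b) / 2) • (ket 0 1 1 0 + ket 1 0 0 1) +
  (Complex.I / (Real.sqrt 2 : ℂ)) • (ket 0 0 0 1 + ket 0 0 1 0 + ket 0 1 1 1 + ket 1 0 1 1)

/-- The family `L_{a₄}`. -/
def La4 (a : ℂ) : Fin 2 → Fin 2 → Fin 2 → Fin 2 → ℂ :=
  a • (ket 0 0 0 0 + ket 0 1 0 1 + ket 1 0 1 0 + ket 1 1 1 1) +
  (Complex.I • ket 0 0 0 1 + ket 0 1 1 0 - Complex.I • ket 1 0 1 1)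

/-- The family `L_{a₂0₃⊕1̄}`. -/
def La2O31 (a : ℂ) : Fin 2 → Fin 2 → Fin 2 → Fin 2 → ℂ :=
  a • (ket 0 0 0 0 + ket 1 1 1 1) + (ket 0 0 1 1 + ket 0 1 0 1 + ket 0 1 1 0)

/-- The family `L_{0₅⊕3̄}`. -/
def LO53 : Fin 2 → Fin 2 → Fin 2 → Fin 2 → ℂ :=
  ket 0 0 0 0 + ket 0 1 0 1 + ket 1 0 0 0 + ket 1 1 1 0

/-- The family `L_{0₇⊕1̄}`. -/
def LO71 : Fin 2 → Fin 2 → Fin 2 → Fin 2 → ℂ :=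
  ket 0 0 0 0 + ket 1 0 1 1 + ket 1 1 0 1 + ket 1 1 1 0

/-- The family `L_{0₃⊕1̄0₃⊕1̄}`. -/
def LO31O31 : Fin 2 → Fin 2 → Fin 2 → Fin 2 → ℂ :=
  ket 0 0 0 0 + ket 0 1 1 1

/-- The four-qubit W state `(1/2)(|0001⟩+|0010⟩+|0100⟩+|1000⟩)`. -/
noncomputable def W4 : Fin 2 → Fin 2 → Fin 2 → Fin 2 → ℂ :=
  (1 / 2 : ℂ) • (ket 0 0 0 1 + ket 0 0 1 0 + ket 0 1 0 0 + ket 1 0 0 0)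

/-- The four-qubit W state belongs to the family `L_{ab₃}` with `a = b = 0`: up to a
permutation of the qubits, a determinant-1 SLOCC operation maps it to
`(i/√2)(|0001⟩+|0010⟩+|0111⟩+|1011⟩)`. -/
theorem W4_in_Lab3_family :
    ∃ (σ : Equiv.Perm (Fin 4)) (A₁ A₂ A₃ A₄ : Matrix (Fin 2) (Fin 2) ℂ),
      A₁.det = 1 ∧ A₂.det = 1 ∧ A₃.det = 1 ∧ A₄.det = 1 ∧
      act A₁ A₂ A₃ A₄ (permAct σ W4) = Lab3 0 0 := by
  have hsqrt : (Real.sqrt 2 : ℂ) ^ 2 = 2 := by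
    exact_mod_cast Real.sq_sqrt (by norm_num : (0 : ℝ) ≤ 2)
  have hsqrt0 : (Real.sqrt 2 : ℂ) ≠ 0 := by
    exact_mod_cast (Real.sqrt_pos.2 (by norm_num : (0 : ℝ) < 2)).ne'
  obtain ⟨t, ht⟩ := IsAlgClosed.exists_pow_nat_eq (-Complex.I * (Real.sqrt 2 : ℂ)) two_pos
  have ht0 : t ≠ 0 := by
    rintro rfl
    simp [Complex.I_ne_zero] at ht
  have hcoeff : Complex.I / (Real.sqrt 2 : ℂ) = -t ^ 2 / 2 := by
    rw [ht]
    field_simp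
    linear_combination -hsqrt
  refine ⟨1, !![t, 0; 0, t⁻¹], !![t, 0; 0, t⁻¹],
    !![0, Complex.I * t⁻¹; Complex.I * t, 0], !![0, Complex.I * t⁻¹; Complex.I * t, 0],
    ?_, ?_, ?_, ?_, ?_⟩
  iterate 2 simp [det_fin_two_of, ht0]
  iterate 2
    rw [det_fin_two_of]
    field_simp
    simp
  funext i₁ i₂ i₃ i₄
  fin_cases i₁ <;> fin_cases i₂ <;> fin_cases i₃ <;> fin_cases i₄ <;>
    simp [act, permAct, W4, Lab3, ket, hcoeff] <;>
    field_simp <;>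
    simp
end
end
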